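/- The Hilbert system over 𝔏 consisting of all classical propositional tautologies, all instances of (B1) (□_Gφ ∧ □_Hψ) → □_{G∪H}(φ∧ψ) for disjoint finite nonempty G, H ⊆ I, and the necessitation axioms □_i⊤ for all i ∈ I, closed under modus ponens and replacement of equivalents (RE), is sound and strongly complete with respect to the class of all models in which W ∈ N_i(w) for all i ∈ I and all worlds w. -/

import Mathlib

attribute [local instance] Classical.propDecidable

/-- Formulas of the multi-modal language 𝔏: atoms, ⊥, ¬, ∨, and □_G for
finite nonempty G ⊆ I. -/
inductive Form (I : Type) : Type
  | atom : ℕ → Form I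
  | bot  : Form I
  | neg  : Form I → Form I
  | or   : Form I → Form I → Form I
  | box  : (G : Finset I) → G.Nonempty → Form I → Form I

namespace Form
variable {I : Type}
/-- φ ∧ ψ -/
def and (φ ψ : Form I) : Form I := .neg (.or (.neg φ) (.neg ψ))
/-- φ → ψ -/
def imp (φ ψ : Form I) : Form I := .or (.neg φ) ψ
/-- ⊤ -/
def top : Form I := .neg .bot
/-- φ ↔ ψ -/
def iff (φ ψ : Form I) : Form I := (φ.imp ψ).and (ψ.imp φ)
end Form

/-- The pointwise-intersection neighbourhood function:
`N_G(w) = { ⋂_{i∈G} X_i : X_i ∈ N_i(w) }`. -/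
def ptwInter {I W : Type} (N : I → W → Set (Set W)) (G : Finset I) (w : W) :
    Set (Set W) :=
  { X | ∃ Y : I → Set W, (∀ i ∈ G, Y i ∈ N i w) ∧ X = ⋂ i ∈ G, Y i }

/-- Satisfaction at a world, relative to neighbourhood functions `N` and a
valuation `V`. -/
def satN {I W : Type} (N : I → W → Set (Set W)) (V : ℕ → Set W) :
    Form I → W → Prop
  | .atom n, w => w ∈ V n
  | .bot, _ => False
  | .neg φ, w => ¬ satN N V φ w
  | .or φ ψ, w => satN N V φ w ∨ satN N V ψ w
  | .box G _ φ, w => { v | satN N V φ v } ∈ ptwInter N G w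

/-- A neighbourhood model. -/
structure NbhModel (I : Type) where
  W : Type
  ne : Nonempty W
  N : I → W → Set (Set W)
  V : ℕ → Set W

/-- Truth in a model. -/
def NbhModel.sat {I : Type} (M : NbhModel I) (w : M.W) (φ : Form I) : Prop :=
  satN M.N M.V φ w

/-- Propositional evaluation treating atoms and boxed formulas as atomic. -/
def evalP {I : Type} (v : Form I → Prop) : Form I → Prop
  | .atom n => v (.atom n)
  | .bot => False
  | .neg φ => ¬ evalP v φ
  | .or φ ψ => evalP v φ ∨ evalP v ψ
  | .box G h φ => v (.box G h φ)

/-- Classical propositional tautologies (in the extended modal language). -/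
def Tautology {I : Type} (φ : Form I) : Prop := ∀ v, evalP v φ

theorem unionNE {I : Type} [DecidableEq I] {G H : Finset I}
    (hG : G.Nonempty) : (G ∪ H).Nonempty :=
  hG.mono Finset.subset_union_left

/-- Axiom schema B1: `(□_Gφ ∧ □_Hψ) → □_{G∪H}(φ∧ψ)` for disjoint G, H. -/
def B1Ax (I : Type) [DecidableEq I] : Set (Form I) :=
  { χ | ∃ (G H : Finset I) (hG : G.Nonempty) (hH : H.Nonempty) (φ ψ : Form I),
      Disjoint G H ∧
      χ = ((Form.box G hG φ).and (Form.box H hH ψ)).imp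
            (Form.box (G ∪ H) (unionNE hG) (φ.and ψ)) }

/-- Axiom schema B2: `□_{G∪H}⊤ → □_G⊤`. -/
def B2Ax (I : Type) [DecidableEq I] : Set (Form I) :=
  { χ | ∃ (G H : Finset I) (hG : G.Nonempty) (_hH : H.Nonempty),
      χ = (Form.box (G ∪ H) (unionNE hG) Form.top).imp (Form.box G hG Form.top) }

/-- Axiom schema B3: `(□_Gφ ∧ □_{G∪H∪J}φ) → □_{G∪H}φ`. -/
def B3Ax (I : Type) [DecidableEq I] : Set (Form I) :=
  { χ | ∃ (G H J : Finset I) (hG : G.Nonempty) (_hH : H.Nonempty)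
      (_hJ : J.Nonempty) (φ : Form I),
      χ = ((Form.box G hG φ).and (Form.box (G ∪ H ∪ J) (unionNE (unionNE hG)) φ)).imp
            (Form.box (G ∪ H) (unionNE hG) φ) }

/-- Axiom schema B4: `(□_Gφ ∧ □_H(φ∨ψ)) → □_{G∪H}φ`. -/
def B4Ax (I : Type) [DecidableEq I] : Set (Form I) :=
  { χ | ∃ (G H : Finset I) (hG : G.Nonempty) (hH : H.Nonempty) (φ ψ : Form I),
      χ = ((Form.box G hG φ).and (Form.box H hH (φ.or ψ))).imp
            (Form.box (G ∪ H) (unionNE hG) φ) }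

/-- The axioms of the base logic. -/
def BaseAx (I : Type) [DecidableEq I] : Set (Form I) :=
  B1Ax I ∪ B2Ax I ∪ B3Ax I ∪ B4Ax I

/-- Hilbert-style provability from classical tautologies and the axioms in
`Ax`, closed under modus ponens and replacement of equivalents. -/
inductive Prv {I : Type} (Ax : Set (Form I)) : Form I → Prop
  | taut {φ : Form I} : Tautology φ → Prv Ax φ
  | ax {φ : Form I} : φ ∈ Ax → Prv Ax φ
  | mp {φ ψ : Form I} : Prv Ax (φ.imp ψ) → Prv Ax φ → Prv Ax ψ
  | re {φ ψ : Form I} (G : Finset I) (hG : G.Nonempty) :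
      Prv Ax (φ.iff ψ) → Prv Ax ((Form.box G hG φ).iff (Form.box G hG ψ))

/-- `Γ ⊢ φ` iff there are `ψ₁,…,ψₙ ∈ Γ` with `⊢ (ψ₁∧…∧ψₙ) → φ`. -/
def Deduces {I : Type} (Ax : Set (Form I)) (Γ : Set (Form I)) (φ : Form I) :
    Prop :=
  ∃ l : List (Form I), (∀ ψ ∈ l, ψ ∈ Γ) ∧
    Prv Ax ((l.foldr Form.and Form.top).imp φ)

/-- Semantic consequence over a class of models. -/
def SemConseq {I : Type} (C : NbhModel I → Prop) (Γ : Set (Form I))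
    (φ : Form I) : Prop :=
  ∀ M : NbhModel I, C M → ∀ w : M.W, (∀ ψ ∈ Γ, M.sat w ψ) → M.sat w φ

/-- Soundness and strong completeness of `Ax` w.r.t. the class `C`. -/
def SoundComplete {I : Type} (Ax : Set (Form I)) (C : NbhModel I → Prop) :
    Prop :=
  ∀ (Γ : Set (Form I)) (φ : Form I), Deduces Ax Γ φ ↔ SemConseq C Γ φ

/-- The necessitation axioms: □_i⊤ for all i ∈ I. -/
def NecAx (I : Type) : Set (Form I) :=
  { χ | ∃ i : I, χ = Form.box {i} (Finset.singleton_nonempty i) Form.top }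

section Propositional

variable {I : Type} {v : Form I → Prop}

@[simp] theorem evalP_neg (φ : Form I) : evalP v (.neg φ) ↔ ¬ evalP v φ := Iff.rfl

@[simp] theorem evalP_or (φ ψ : Form I) : evalP v (.or φ ψ) ↔ evalP v φ ∨ evalP v ψ := Iff.rfl

@[simp] theorem evalP_box (G : Finset I) (hG : G.Nonempty) (φ : Form I) :
    evalP v (.box G hG φ) ↔ v (.box G hG φ) := Iff.rfl

@[simp] theorem evalP_and (φ ψ : Form I) : evalP v (φ.and ψ) ↔ evalP v φ ∧ evalP v ψ := by
  simp [Form.and]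

@[simp] theorem evalP_imp (φ ψ : Form I) : evalP v (φ.imp ψ) ↔ (evalP v φ → evalP v ψ) := by
  simp [Form.imp, imp_iff_not_or]

@[simp] theorem evalP_top : evalP v (Form.top : Form I) := fun h => h

@[simp] theorem evalP_iff (φ ψ : Form I) : evalP v (φ.iff ψ) ↔ (evalP v φ ↔ evalP v ψ) := by
  simp [Form.iff, iff_iff_implies_and_implies]

@[simp] theorem evalP_foldr_and (l : List (Form I)) :
    evalP v (l.foldr Form.and Form.top) ↔ ∀ ψ ∈ l, evalP v ψ := by
  induction l <;> simp_all

/-- Truth in a model commutes with the propositional connectives. -/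
theorem satN_eq_evalP {W : Type} (N : I → W → Set (Set W)) (V : ℕ → Set W) (w : W)
    (φ : Form I) : satN N V φ w ↔ evalP (fun χ => satN N V χ w) φ := by
  induction φ with
  | atom n => rfl
  | bot => rfl
  | neg φ ih => simp [satN, ih]
  | or φ ψ ih₁ ih₂ => simp [satN, ih₁, ih₂]
  | box G hG φ _ => rfl

theorem isClopen_setOf_evalP (φ : Form I) :
    IsClopen {v : Form I → Bool | evalP (fun χ => v χ = true) φ} := by
  induction φ with
  | atom n =>
    exact (isClopen_discrete {true}).preimage (continuous_apply (Form.atom n : Form I))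
  | bot => exact isClopen_empty
  | neg φ ih => exact ih.compl
  | or φ ψ ih₁ ih₂ => exact ih₁.union ih₂
  | box G hG φ _ => exact (isClopen_discrete {true}).preimage (continuous_apply (Form.box G hG φ))

end Propositional

section Deduction

variable {I : Type} {Ax : Set (Form I)} {Γ : Set (Form I)}

theorem Deduces.of_tautology_foldr (l : List (Form I)) (hl : ∀ ψ ∈ l, Prv Ax ψ ∨ ψ ∈ Γ)
    (φ : Form I) (h : Tautology ((l.foldr Form.and Form.top).imp φ)) : Deduces Ax Γ φ := by
  induction l generalizing φ with
  | nil => exact ⟨[], by simp, .taut h⟩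
  | cons a l ih =>
    obtain ⟨m, hm, hp⟩ := ih (fun ψ hψ => hl ψ (List.mem_cons_of_mem _ hψ)) (a.imp φ)
      (fun v => by have := h v; simp_all)
    rcases hl a List.mem_cons_self with ha | ha
    · exact ⟨m, hm, .mp (.mp (.taut fun v => by simp; tauto) hp) ha⟩
    · exact ⟨a :: m, by simpa [ha] using hm, .mp (.taut fun v => by simp; tauto) hp⟩

/-- A valuation of the atoms and boxed formulas making all theorems true. -/
def IsTheoremValuation (Ax : Set (Form I)) (v : Form I → Prop) : Prop :=
  ∀ χ, Prv Ax χ → evalP v χ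

theorem Deduces.of_forall_valuation (φ : Form I)
    (h : ∀ v, IsTheoremValuation Ax v → (∀ ψ ∈ Γ, evalP v ψ) → evalP v φ) :
    Deduces Ax Γ φ := by
  by_contra hφ
  have key := (isClopen_setOf_evalP φ).compl.isClosed.isCompact.inter_iInter_nonempty
    (fun χ : {χ // Prv Ax χ ∨ χ ∈ Γ} => {v : Form I → Bool | evalP (fun χ => v χ = true) χ.1})
    (fun χ => (isClopen_setOf_evalP χ.1).isClosed) ?_
  · obtain ⟨v, hv, hT⟩ := key
    rw [Set.mem_iInter] at hT
    exact hv (h _ (fun χ hχ => hT ⟨χ, .inl hχ⟩) fun χ hχ => hT ⟨χ, .inr hχ⟩)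
  · intro u
    by_contra hu
    refine hφ (.of_tautology_foldr (u.toList.map Subtype.val) (by simp; tauto) φ fun v => ?_)
    simp only [evalP_imp, evalP_foldr_and]
    intro hv
    by_contra hvφ
    refine hu ⟨fun χ => decide (v χ), by simpa using hvφ, ?_⟩
    simp only [Set.mem_iInter]
    intro χ hχ
    simpa using hv χ.1 (by simpa using ⟨χ.2, hχ⟩)

theorem Prv.of_forall_valuation (φ : Form I)
    (h : ∀ v, IsTheoremValuation Ax v → evalP v φ) : Prv Ax φ := by
  obtain ⟨l, hl, hp⟩ := Deduces.of_forall_valuation (Γ := ∅) φ fun v hv _ => h v hv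
  exact .mp hp (.taut fun v => by simpa using fun ψ hψ => (hl ψ hψ).elim)

theorem IsTheoremValuation.box_congr {v : Form I → Prop} (hv : IsTheoremValuation Ax v)
    {φ ψ : Form I} (h : ∀ u, IsTheoremValuation Ax u → (evalP u φ ↔ evalP u ψ))
    {G : Finset I} (hG : G.Nonempty) : v (.box G hG φ) ↔ v (.box G hG ψ) := by
  simpa using hv _ (Prv.re G hG (.of_forall_valuation (φ.iff ψ) (by simpa using h)))

/-- Soundness for any class of models validating the axioms. -/
theorem SemConseq.of_deduces {C : NbhModel I → Prop}
    (hAx : ∀ χ ∈ Ax, ∀ M, C M → ∀ w, M.sat w χ) {φ : Form I} (h : Deduces Ax Γ φ) :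
    SemConseq C Γ φ := by
  have sound : ∀ χ, Prv Ax χ → ∀ M, C M → ∀ w, M.sat w χ := by
    intro χ hχ
    induction hχ with
    | taut h => exact fun M _ w => (satN_eq_evalP ..).2 (h _)
    | ax h => exact hAx _ h
    | mp _ _ ih₁ ih₂ =>
      intro M hM w
      have h₁ := (satN_eq_evalP ..).1 (ih₁ M hM w)
      rw [evalP_imp] at h₁
      exact (satN_eq_evalP ..).2 (h₁ ((satN_eq_evalP ..).1 (ih₂ M hM w)))
    | @re φ ψ G hG _ ih =>
      intro M hM w
      have hset : {w | satN M.N M.V φ w} = {w | satN M.N M.V ψ w} := by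
        ext w
        have h := (satN_eq_evalP ..).1 (ih M hM w)
        rwa [evalP_iff, ← satN_eq_evalP, ← satN_eq_evalP] at h
      refine (satN_eq_evalP ..).2 ?_
      simp [satN, hset]
  obtain ⟨l, hl, hp⟩ := h
  intro M hM w hΓ
  have hp := (satN_eq_evalP ..).1 (sound _ hp M hM w)
  rw [evalP_imp, evalP_foldr_and, ← satN_eq_evalP] at hp
  exact hp fun ψ hψ => (satN_eq_evalP ..).1 (hΓ ψ (hl ψ hψ))

end Deduction

section PointwiseIntersection

variable {I W : Type} [DecidableEq I] {N : I → W → Set (Set W)}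

theorem ptwInter_union {G H : Finset I} (hd : Disjoint G H) {w : W} {X Z : Set W}
    (hX : X ∈ ptwInter N G w) (hZ : Z ∈ ptwInter N H w) : X ∩ Z ∈ ptwInter N (G ∪ H) w := by
  obtain ⟨Y, hY, rfl⟩ := hX
  obtain ⟨Y', hY', rfl⟩ := hZ
  have hG : ∀ i ∈ G, (if i ∈ G then Y i else Y' i) = Y i := fun i hi => if_pos hi
  have hH : ∀ i ∈ H, (if i ∈ G then Y i else Y' i) = Y' i :=
    fun i hi => if_neg (Finset.disjoint_right.1 hd hi)
  refine ⟨fun i => if i ∈ G then Y i else Y' i, fun i hi => ?_, ?_⟩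
  · rcases Finset.mem_union.1 hi with hi | hi
    · simpa only [hG i hi] using hY i hi
    · simpa only [hH i hi] using hY' i hi
  · rw [← Set.iInter₂_congr hG, ← Set.iInter₂_congr hH]
    exact Finset.iInf_union.symm

theorem sat_of_mem_B1Nec {χ : Form I} (hχ : χ ∈ B1Ax I ∪ NecAx I) (M : NbhModel I)
    (hM : ∀ (i : I) (w : M.W), Set.univ ∈ M.N i w) (w : M.W) : M.sat w χ := by
  refine (satN_eq_evalP ..).2 ?_
  rcases hχ with ⟨G, H, hG, hH, φ, ψ, hd, rfl⟩ | ⟨i, rfl⟩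
  · simp only [evalP_imp, evalP_and, evalP_box, satN]
    rintro ⟨h₁, h₂⟩
    convert ptwInter_union hd h₁ h₂ using 1
    ext u
    simp only [Set.mem_ofPred_eq, Set.mem_inter_iff]
    rw [satN_eq_evalP, evalP_and, ← satN_eq_evalP, ← satN_eq_evalP]
  · refine ⟨fun _ => Set.univ, fun j _ => hM j w, ?_⟩
    simp [Form.top, satN]

end PointwiseIntersection

section Canonical

variable {I : Type}

/-- Pairs `(G, φ)` indexing the boxed formulas `□_G φ`. -/
abbrev BoxIndex (I : Type) : Type := {G : Finset I // G.Nonempty} × Form I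

/-- The boxed formula with a given index. -/
def BoxIndex.form (p : BoxIndex I) : Form I := .box p.1.1 p.1.2 p.2

/-- Worlds of the canonical model: a valuation making all theorems true, together with a choice,
for each boxed formula `□_G φ`, of an element of `G`. -/
abbrev CanonicalWorld (Ax : Set (Form I)) : Type :=
  {v : Form I → Prop // IsTheoremValuation Ax v} × ((p : BoxIndex I) → {i // i ∈ p.1.1})

/-- The neighbourhood contributed by agent `i` towards the truth of `□_G φ`. Over all `i ∈ G`
these intersect in the truth set of `φ`; if some agent in `G` is left out, they impose no
restriction at some choice. -/
def contribution (Ax : Set (Form I)) (i : I) (p : BoxIndex I) : Set (CanonicalWorld Ax) :=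
  {w | evalP w.1.1 p.2 ∨ (w.2 p).1 ≠ i}

/-- The canonical neighbourhood functions. -/
def canonicalN (Ax : Set (Form I)) (i : I) (w : CanonicalWorld Ax) :
    Set (Set (CanonicalWorld Ax)) :=
  {X | ∃ p : BoxIndex I, i ∈ p.1.1 ∧ w.1.1 p.form ∧ X = contribution Ax i p}

/-- The canonical valuation. -/
def canonicalV (Ax : Set (Form I)) (n : ℕ) : Set (CanonicalWorld Ax) :=
  {w | w.1.1 (.atom n)}

theorem exists_conjunction (F : Finset (BoxIndex I)) :
    ∃ χ : Form I, ∀ v : Form I → Prop, evalP v χ ↔ ∀ q ∈ F, evalP v q.2 :=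
  ⟨(F.toList.map Prod.snd).foldr Form.and Form.top, fun v => by
    rw [evalP_foldr_and]; simp; aesop⟩

variable [DecidableEq I]

theorem IsTheoremValuation.box_union {v : Form I → Prop}
    (hv : IsTheoremValuation (B1Ax I ∪ NecAx I) v) {G H K : Finset I} (hG : G.Nonempty)
    (hH : H.Nonempty) (hK : K.Nonempty) (hd : Disjoint G H) (hGH : G ∪ H = K) {φ ψ χ : Form I}
    (hφ : v (.box G hG φ)) (hψ : v (.box H hH ψ))
    (hχ : ∀ u, IsTheoremValuation (B1Ax I ∪ NecAx I) u →
      (evalP u χ ↔ evalP u φ ∧ evalP u ψ)) : v (.box K hK χ) := by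
  subst hGH
  refine (hv.box_congr (ψ := φ.and ψ) (by simpa using hχ) hK).2 ?_
  have h := hv _ (.ax (.inl ⟨G, H, hG, hH, φ, ψ, hd, rfl⟩))
  simp only [evalP_imp, evalP_and, evalP_box] at h
  exact h ⟨hφ, hψ⟩

theorem IsTheoremValuation.box_top {v : Form I → Prop}
    (hv : IsTheoremValuation (B1Ax I ∪ NecAx I) v) {G : Finset I} (hG : G.Nonempty) :
    v (.box G hG .top) := by
  have single : ∀ i : I, v (.box {i} (Finset.singleton_nonempty i) .top) :=
    fun i => hv _ (.ax (.inr ⟨i, rfl⟩))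
  induction hG using Finset.Nonempty.cons_induction with
  | singleton i => exact single i
  | cons i s hi hs ih =>
    exact hv.box_union (Finset.singleton_nonempty i) hs _ (by simpa using hi)
      (by rw [Finset.cons_eq_insert, Finset.insert_eq]) (single i) ih (by simp)

/-- Aggregation of boxes over pairwise disjoint groups contained in `H`. -/
theorem IsTheoremValuation.box_of_pairwiseDisjoint {v : Form I → Prop}
    (hv : IsTheoremValuation (B1Ax I ∪ NecAx I) v) (F : Finset (BoxIndex I))
    (hd : (F : Set (BoxIndex I)).PairwiseDisjoint fun q => q.1.1)
    (hF : ∀ q ∈ F, v q.form) {H : Finset I} (hH : H.Nonempty) (hFH : ∀ q ∈ F, q.1.1 ⊆ H)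
    {χ : Form I} (hχ : ∀ u, IsTheoremValuation (B1Ax I ∪ NecAx I) u →
      (evalP u χ ↔ ∀ q ∈ F, evalP u q.2)) : v (.box H hH χ) := by
  induction F using Finset.induction_on generalizing H χ with
  | empty => exact (hv.box_congr (by simpa using hχ) hH).2 (hv.box_top hH)
  | insert q F hq ih =>
    rw [Finset.coe_insert, Set.pairwiseDisjoint_insert_of_notMem (by simpa using hq)] at hd
    simp only [Finset.mem_insert, forall_eq_or_imp] at hF hFH hχ
    have hsub : ∀ r ∈ F, r.1.1 ⊆ H \ q.1.1 := fun r hr =>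
      Finset.subset_sdiff.2 ⟨hFH.2 r hr, (hd.2 r hr).symm⟩
    obtain ⟨ψ, hψ⟩ := exists_conjunction F
    rcases (H \ q.1.1).eq_empty_or_nonempty with he | hne
    · obtain rfl : q.1.1 = H := hFH.1.antisymm (Finset.sdiff_eq_empty_iff_subset.1 he)
      have hempty : ∀ r, r ∉ F := fun r hr =>
        r.1.2.ne_empty (Finset.subset_empty.1 (he ▸ hsub r hr))
      refine (hv.box_congr (fun u hu => (hχ u hu).trans ?_) hH).2 hF.1
      simp [hempty]
    · exact hv.box_union q.1.2 hne hH Finset.disjoint_sdiff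
        (Finset.union_sdiff_of_subset hFH.1) hF.1 (ih hd.1 hF.2 hne hsub fun u _ => hψ u)
        fun u hu => by rw [hχ u hu, hψ u]

theorem mem_ptwInter_canonicalN_iff (w : CanonicalWorld (B1Ax I ∪ NecAx I)) (G : Finset I)
    (hG : G.Nonempty) (φ : Form I) :
    {u | evalP u.1.1 φ} ∈ ptwInter (canonicalN (B1Ax I ∪ NecAx I)) G w ↔
      w.1.1 (.box G hG φ) := by
  constructor
  · rintro ⟨Y, hY, hφ⟩
    have : ∀ i, ∃ p : BoxIndex I, i ∈ G → i ∈ p.1.1 ∧ w.1.1 p.form ∧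
        Y i = contribution _ i p := by
      intro i
      by_cases hi : i ∈ G
      · obtain ⟨p, hp⟩ := hY i hi
        exact ⟨p, fun _ => hp⟩
      · exact ⟨(⟨G, hG⟩, φ), fun h => (hi h).elim⟩
    choose p hp using this
    let full : BoxIndex I → Prop := fun q => ∀ j ∈ q.1.1, j ∈ G ∧ p j = q
    have hk : ∀ q : BoxIndex I, ∃ k : {i // i ∈ q.1.1}, ¬ full q → ¬ (k.1 ∈ G ∧ p k.1 = q) := by
      intro q
      by_cases hq : full q
      · exact ⟨⟨_, q.1.2.choose_spec⟩, fun h => (h hq).elim⟩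
      · obtain ⟨j, hj, hj'⟩ : ∃ j ∈ q.1.1, ¬ (j ∈ G ∧ p j = q) := by
          by_contra! h
          exact hq h
        exact ⟨⟨j, hj⟩, fun _ => hj'⟩
    choose k hk using hk
    refine w.1.2.box_of_pairwiseDisjoint ((G.image p).filter full) ?_ ?_ hG ?_ ?_
    · intro q hq r hr hqr
      simp only [Finset.coe_filter, Set.mem_ofPred_eq] at hq hr
      exact Finset.disjoint_left.2 fun j hjq hjr =>
        hqr ((hq.2 j hjq).2.symm.trans (hr.2 j hjr).2)
    · intro q hq
      simp only [Finset.mem_filter, Finset.mem_image] at hq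
      obtain ⟨⟨i, hi, rfl⟩, -⟩ := hq
      exact (hp i hi).2.1
    · intro q hq j hj
      exact ((Finset.mem_filter.1 hq).2 j hj).1
    · intro u hu
      have hmem := Set.ext_iff.1 hφ (⟨u, hu⟩, k)
      simp only [Set.mem_ofPred_eq, Set.mem_iInter] at hmem
      rw [hmem]
      simp only [Finset.mem_filter, Finset.mem_image]
      constructor
      · rintro h q ⟨⟨i, hi, rfl⟩, hfull⟩
        obtain ⟨hjG, hjp⟩ := hfull _ (k (p i)).2
        have hj := h _ hjG
        rw [(hp _ hjG).2.2, hjp] at hj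
        exact hj.resolve_right (not_not.2 rfl)
      · intro h i hi
        rw [(hp i hi).2.2]
        by_cases hfull : full (p i)
        · exact .inl (h _ ⟨⟨i, hi, rfl⟩, hfull⟩)
        · exact .inr fun he => hk _ hfull (by rw [show (k (p i)).1 = i from he]; exact ⟨hi, rfl⟩)
  · intro h
    refine ⟨fun i => contribution _ i (⟨G, hG⟩, φ), fun i hi => ⟨(⟨G, hG⟩, φ), hi, h, rfl⟩, ?_⟩
    ext u
    simp only [contribution, Set.mem_ofPred_eq, Set.mem_iInter]
    exact ⟨fun hu _ _ => .inl hu,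
      fun hu => (hu _ (u.2 (⟨G, hG⟩, φ)).2).resolve_right (not_not.2 rfl)⟩

theorem satN_canonical_iff (φ : Form I) (w : CanonicalWorld (B1Ax I ∪ NecAx I)) :
    satN (canonicalN _) (canonicalV _) φ w ↔ evalP w.1.1 φ := by
  induction φ generalizing w with
  | atom n => rfl
  | bot => rfl
  | neg φ ih => simp [satN, ih]
  | or φ ψ ih₁ ih₂ => simp [satN, ih₁, ih₂]
  | box G hG φ ih =>
    simp only [satN, ih, evalP_box]
    exact mem_ptwInter_canonicalN_iff w G hG φ

theorem univ_mem_canonicalN (i : I) (w : CanonicalWorld (B1Ax I ∪ NecAx I)) :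
    Set.univ ∈ canonicalN _ i w :=
  ⟨(⟨{i}, Finset.singleton_nonempty i⟩, .top), Finset.mem_singleton_self i, w.1.2.box_top _,
    (Set.eq_univ_of_forall fun _ => .inl evalP_top).symm⟩

end Canonical

/-- The Hilbert system with classical tautologies, B1 and the
necessitation axioms □_i⊤ (closed under MP and RE) is sound and strongly
complete w.r.t. the class of all models in which W ∈ N_i(w) for all i ∈ I
and all worlds w. -/
theorem B1Nec_sound_complete (I : Type) [DecidableEq I] :
    SoundComplete (B1Ax I ∪ NecAx I)
      (fun M : NbhModel I => ∀ (i : I) (w : M.W), Set.univ ∈ M.N i w) := by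
  intro Γ φ
  refine ⟨fun h => .of_deduces (fun χ hχ M hM => sat_of_mem_B1Nec hχ M hM) h, fun h => ?_⟩
  refine .of_forall_valuation φ fun v hv hΓ => ?_
  let w : CanonicalWorld (B1Ax I ∪ NecAx I) := (⟨v, hv⟩, fun p => ⟨_, p.1.2.choose_spec⟩)
  exact (satN_canonical_iff φ w).1 (h ⟨_, ⟨w⟩, canonicalN _, canonicalV _⟩ univ_mem_canonicalN w
    fun ψ hψ => (satN_canonical_iff ψ w).2 (hΓ ψ hψ))
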